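/- Let B ∈ V(A'(T)), let f(x) be a 0-absorbing unary polynomial of B, and let g(x) = f(S_j(n̄,p,q,x)) for some j ∈ {0,1,2}, n̄ ∈ B² ∪ B, and p,q ∈ B. If c, d ∈ B satisfy d ≤ c, then the polynomial g'(x) = S_j(n̄, g(c), g(d), f(x)) satisfies g'(c) = g(c) and g'(d) = g(d). -/

import Mathlib

open FirstOrder

namespace McKenzie

/-- A Turing machine instruction `(s, r, w, d, t)`: "in state `s` reading `r`,
write `w`, move in direction `d` (`true` = right, `false` = left), enter state `t`". -/
structure Instr (n : ℕ) where
  s : Fin (n + 1)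
  r : Bool
  w : Bool
  d : Bool
  t : Fin (n + 1)

/-- A Turing machine: a finite list of instructions on states `μ0, …, μn`
(represented by `Fin (states+1)`), where `μ0` is the halting state (carrying no
instructions) and `μ1` is the initial state. -/
structure TM where
  states : ℕ
  instr : List (Instr states)
  halt_no_instr : ∀ i ∈ instr, i.s ≠ 0

/-- A configuration of a Turing machine: a tape, a head position and a state. -/
structure Cfg (T : TM) where
  tape : ℤ → Bool
  head : ℤ
  state : Fin (T.states + 1)

/-- One computation step of the machine (using the first applicable instruction). -/
def TM.step (T : TM) (Q : Cfg T) : Option (Cfg T) :=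
  match T.instr.find? (fun i => decide (i.s = Q.state ∧ i.r = Q.tape Q.head)) with
  | none => none
  | some i =>
      some ⟨Function.update Q.tape Q.head i.w,
        if i.d then Q.head + 1 else Q.head - 1, i.t⟩

/-- The configuration after `n` steps when started in state `μ1` on the blank tape. -/
def TM.run (T : TM) : ℕ → Option (Cfg T)
  | 0 => some ⟨fun _ => false, 0, 1⟩
  | n + 1 => (T.run n).bind T.step

/-- `T` halts (started in the initial state `μ1` on the empty, all-zero, tape). -/
def TM.Halts (T : TM) : Prop := ∃ (n : ℕ) (Q : Cfg T), T.run n = some Q ∧ Q.state = 0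

/-- The universe of the algebra `A'(T)`:
`0`, `U = {1,2,H}`, `W = {C, D, ∂C, ∂D}`, and
`V = {C_ir^s, D_ir^s, M_i^r}` together with their barred versions. -/
inductive El (T : TM) : Type
  | zero
  | one
  | two
  | H
  | C (bar : Bool)
  | D (bar : Bool)
  | Cv (bar : Bool) (i : Fin (T.states + 1)) (r s : Bool)
  | Dv (bar : Bool) (i : Fin (T.states + 1)) (r s : Bool)
  | Mv (bar : Bool) (i : Fin (T.states + 1)) (r : Bool)
  deriving DecidableEq

namespace El

variable {T : TM}

/-- The bar involution `∂`, defined (only) on `V ∪ W`. -/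
def bar : El T → Option (El T)
  | C b => some (C (!b))
  | D b => some (D (!b))
  | Cv b i r s => some (Cv (!b) i r s)
  | Dv b i r s => some (Dv (!b) i r s)
  | Mv b i r => some (Mv (!b) i r)
  | _ => none

/-- The flat (height 1) semilattice meet with bottom element `0`. -/
def meet (x y : El T) : El T := if x = y then x else zero

/-- Join in the flat semilattice, for comparable elements. -/
def fjoin (x y : El T) : El T := if x = zero then y else x

/-- The nonassociative multiplication: `2·D = H·C = D`, `1·C = C`,
`2·∂D = H·∂C = ∂D`, `1·∂C = ∂C`, and `0` otherwise. -/
def mul : El T → El T → El T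
  | two, D b => D b
  | H, C b => D b
  | one, C b => C b
  | _, _ => zero

/-- `J(x,y,z) = (x ∧ ∂y ∧ z) ∨ (x ∧ y)`. -/
def opJ (x y z : El T) : El T :=
  if x = y then x else if bar y = some x then meet x z else zero

/-- `J'(x,y,z) = (x ∧ y ∧ z) ∨ (x ∧ ∂y)`. -/
def opJ' (x y z : El T) : El T :=
  if x = y then meet x z else if bar y = some x then x else zero

/-- `K(x,y,z) = (∂x ∧ y) ∨ (∂x ∧ ∂y ∧ z) ∨ (x ∧ y ∧ z)`. -/
def opK (x y z : El T) : El T :=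
  if bar y = some x then y
  else if x = y ∧ bar z = some x then z
  else meet x (meet y z)

/-- `(x ∧ y) ∨ (x ∧ z)`. -/
def sCore (x y z : El T) : El T := fjoin (meet x y) (meet x z)

/-- Membership in `V₀` (the elements of `V` with state index `0`). -/
def isV0 : El T → Bool
  | Cv _ i _ _ => decide (i = 0)
  | Dv _ i _ _ => decide (i = 0)
  | Mv _ i _ => decide (i = 0)
  | _ => false

/-- `S₀(u,x,y,z) = (x∧y) ∨ (x∧z)` if `u ∈ V₀`, else `0`. -/
def opS0 (u x y z : El T) : El T := if isV0 u then sCore x y z else zero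

/-- `S₁(u,x,y,z) = (x∧y) ∨ (x∧z)` if `u ∈ {1,2}`, else `0`. -/
def opS1 (u x y z : El T) : El T := if u = one ∨ u = two then sCore x y z else zero

/-- `S₂(u,v,x,y,z) = (x∧y) ∨ (x∧z)` if `u = ∂v ∈ V ∪ W`, else `0`. -/
def opS2 (u v x y z : El T) : El T := if bar v = some u then sCore x y z else zero

/-- The operation `T(w,x,y,z)`. -/
def opT (w x y z : El T) : El T :=
  if mul w x = mul y z then
    if w = y ∧ x = z then mul w x
    else if mul w x ≠ zero then (bar (mul w x)).getD zero else zero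
  else zero

/-- `I(1) = C₁₀⁰`, `I(H) = M₁⁰`, `I(2) = D₁₀⁰`, and `0` otherwise. -/
def opI : El T → El T
  | one => Cv false 1 false false
  | H => Mv false 1 false
  | two => Dv false 1 false false
  | _ => zero

/-- The left-moving machine operation `L_{irt}` attached to an instruction
`(μ_i, r, s, L, μ_j)` and `t ∈ {0,1}`. -/
def opL (ins : Instr T.states) (t : Bool) : El T → El T → El T → El T
  | one, one, Cv b i r s' => if i = ins.s ∧ r = ins.r then Cv b ins.t t s' else zero
  | H, one, Cv b i r s' => if i = ins.s ∧ r = ins.r ∧ s' = t then Mv b ins.t t else zero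
  | two, H, Mv b i r => if i = ins.s ∧ r = ins.r then Dv b ins.t t ins.w else zero
  | two, two, Dv b i r s' => if i = ins.s ∧ r = ins.r then Dv b ins.t t s' else zero
  | _, _, _ => zero

/-- The right-moving machine operation `R_{irt}` attached to an instruction
`(μ_i, r, s, R, μ_j)` and `t ∈ {0,1}`. -/
def opR (ins : Instr T.states) (t : Bool) : El T → El T → El T → El T
  | one, one, Cv b i r s' => if i = ins.s ∧ r = ins.r then Cv b ins.t t s' else zero
  | H, one, Mv b i r => if i = ins.s ∧ r = ins.r then Cv b ins.t t ins.w else zero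
  | two, H, Dv b i r s' => if i = ins.s ∧ r = ins.r ∧ s' = t then Mv b ins.t t else zero
  | two, two, Dv b i r s' => if i = ins.s ∧ r = ins.r then Dv b ins.t t s' else zero
  | _, _, _ => zero

/-- The machine operation (from `𝓛 ∪ 𝓡`) attached to an instruction. -/
def mach (ins : Instr T.states) (t : Bool) (x y u : El T) : El T :=
  if ins.d then opR ins t x y u else opL ins t x y u

/-- The relation `≺` on `{1,2,H}`. -/
def prec : El T → El T → Bool
  | two, two => true
  | two, H => true
  | one, one => true
  | _, _ => false

/-- The operation `U_F^1`. -/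
def opU1 (F : El T → El T → El T → El T) (x y z u : El T) : El T :=
  if prec x z then
    if y = z then F x y u
    else if F x y u ≠ zero then (bar (F x y u)).getD zero else zero
  else zero

/-- The operation `U_F^0`. -/
def opU0 (F : El T → El T → El T → El T) (x y z u : El T) : El T :=
  if prec x z then
    if x = y then F y z u
    else if F y z u ≠ zero then (bar (F y z u)).getD zero else zero
  else zero

end El

/-- The unary operation symbols of `A'(T)`. -/
inductive Ops1 : Type
  | I

/-- The binary operation symbols of `A'(T)`. -/
inductive Ops2 : Type
  | meet
  | mul

/-- The ternary operation symbols of `A'(T)`: `J`, `J'`, `K` and the machine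
operations from `𝓛 ∪ 𝓡` (one for each instruction and each `t ∈ {0,1}`). -/
inductive Ops3 (T : TM) : Type
  | J
  | J'
  | K
  | mach (k : Fin T.instr.length) (t : Bool)

/-- The 4-ary operation symbols of `A'(T)`: `S₀`, `S₁`, `T` and the operations
`U_F^1, U_F^0` for `F ∈ 𝓛 ∪ 𝓡`. -/
inductive Ops4 (T : TM) : Type
  | S0
  | S1
  | T
  | u1 (k : Fin T.instr.length) (t : Bool)
  | u0 (k : Fin T.instr.length) (t : Bool)

/-- The 5-ary operation symbols of `A'(T)`: `S₂`. -/
inductive Ops5 : Type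
  | S2

/-- The signature (similarity type) of the algebra `A'(T)`; the constant symbol
(of arity 0) denotes the bottom element `0`. -/
def Sig (T : TM) : FirstOrder.Language.{0, 0} where
  Functions n :=
    match n with
    | 0 => PUnit
    | 1 => Ops1
    | 2 => Ops2
    | 3 => Ops3 T
    | 4 => Ops4 T
    | 5 => Ops5
    | _ => PEmpty
  Relations _ := PEmpty


/-- The constant symbol `0` as an element of the signature. -/
def fn0 (T : TM) : (Sig T).Functions 0 := PUnit.unit
/-- Unary operation symbols as elements of the signature. -/
def fn1 (T : TM) (o : Ops1) : (Sig T).Functions 1 := o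
/-- Binary operation symbols as elements of the signature. -/
def fn2 (T : TM) (o : Ops2) : (Sig T).Functions 2 := o
/-- Ternary operation symbols as elements of the signature. -/
def fn3 (T : TM) (o : Ops3 T) : (Sig T).Functions 3 := o
/-- 4-ary operation symbols as elements of the signature. -/
def fn4 (T : TM) (o : Ops4 T) : (Sig T).Functions 4 := o
/-- 5-ary operation symbols as elements of the signature. -/
def fn5 (T : TM) (o : Ops5) : (Sig T).Functions 5 := o

/-- The algebra `A'(T)`: the interpretation of the signature `Sig T` on `El T`. -/
instance elStructure (T : TM) : (Sig T).Structure (El T) where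
  funMap {n} f v :=
    match n, f, v with
    | 0, _, _ => El.zero
    | 1, Ops1.I, v => El.opI (v 0)
    | 2, Ops2.meet, v => El.meet (v 0) (v 1)
    | 2, Ops2.mul, v => El.mul (v 0) (v 1)
    | 3, Ops3.J, v => El.opJ (v 0) (v 1) (v 2)
    | 3, Ops3.J', v => El.opJ' (v 0) (v 1) (v 2)
    | 3, Ops3.K, v => El.opK (v 0) (v 1) (v 2)
    | 3, Ops3.mach k t, v => El.mach (T.instr.get k) t (v 0) (v 1) (v 2)
    | 4, Ops4.S0, v => El.opS0 (v 0) (v 1) (v 2) (v 3)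
    | 4, Ops4.S1, v => El.opS1 (v 0) (v 1) (v 2) (v 3)
    | 4, Ops4.T, v => El.opT (v 0) (v 1) (v 2) (v 3)
    | 4, Ops4.u1 k t, v => El.opU1 (El.mach (T.instr.get k) t) (v 0) (v 1) (v 2) (v 3)
    | 4, Ops4.u0 k t, v => El.opU0 (El.mach (T.instr.get k) t) (v 0) (v 1) (v 2) (v 3)
    | 5, Ops5.S2, v => El.opS2 (v 0) (v 1) (v 2) (v 3) (v 4)
    | _ + 6, f, _ => f.elim
  RelMap {n} r _ := r.elim

/-- The product algebra `A'(T)^ι`. -/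
instance piStructure (T : TM) (ι : Type*) : (Sig T).Structure (ι → El T) where
  funMap f v l := Language.Structure.funMap f fun i => v i l
  RelMap r _ := r.elim

open Language

/-- A congruence of an algebra: an equivalence relation compatible with all the
fundamental operations. -/
def IsCongruence (L : Language) (B : Type*) [L.Structure B] (ρ : B → B → Prop) : Prop :=
  Equivalence ρ ∧
    ∀ {n : ℕ} (f : L.Functions n) (v w : Fin n → B),
      (∀ i, ρ (v i) (w i)) → ρ (Structure.funMap f v) (Structure.funMap f w)

/-- `PrinCg L B a b x y` says that `(x, y)` lies in the principal congruence
`Cg^B(a,b)` generated by the pair `(a,b)`. -/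
def PrinCg (L : Language) (B : Type*) [L.Structure B] (a b x y : B) : Prop :=
  ∀ ρ : B → B → Prop, IsCongruence L B ρ → ρ a b → ρ x y

/-- `B` satisfies every identity holding in `A`; by Birkhoff's theorem this says
exactly that `B` belongs to the variety generated by `A`. -/
def ModelsIdsOf (L : Language) (A : Type*) [L.Structure A] (B : Type*) [L.Structure B] : Prop :=
  ∀ t₁ t₂ : L.Term ℕ,
    (∀ v : ℕ → A, t₁.realize v = t₂.realize v) →
    ∀ v : ℕ → B, t₁.realize v = t₂.realize v

/-- Membership in the variety `V(A'(T))` generated by `A'(T)`. -/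
def InVariety (T : TM) (B : Type*) [(Sig T).Structure B] : Prop :=
  ModelsIdsOf (Sig T) (El T) B

/-- The variety `V(A'(T))` as a class of algebras. -/
def VClass (T : TM) : ∀ (B : Type) [inst : (Sig T).Structure B], Prop :=
  fun B inst => @InVariety T B inst

/-- `φ(w,x,y,z)` is a congruence formula for the class `C`: in every member of `C`
it implies `(w,x) ∈ Cg(y,z)`. -/
def IsCongruenceFormula (L : Language) (C : ∀ (B : Type) [inst : L.Structure B], Prop)
    (φ : L.Formula (Fin 4)) : Prop :=
  ∀ (B : Type) [L.Structure B], C B → ∀ w x y z : B,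
    φ.Realize ![w, x, y, z] → PrinCg L B y z w x

/-- The class `C` has definable principal subcongruences: there are congruence
formulas `Γ` and `ψ` such that any pair `a ≠ b` admits a subpair `c ≠ d` of
`Cg(a,b)` (witnessed by `Γ`) whose principal congruence is defined by `ψ`. -/
def HasDPSC (L : Language) (C : ∀ (B : Type) [inst : L.Structure B], Prop) : Prop :=
  ∃ Γ ψ : L.Formula (Fin 4),
    IsCongruenceFormula L C Γ ∧ IsCongruenceFormula L C ψ ∧
      ∀ (B : Type) [L.Structure B], C B → ∀ a b : B, a ≠ b →
        ∃ c d : B, c ≠ d ∧ Γ.Realize ![c, d, a, b] ∧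
          ∀ x y : B, PrinCg L B c d x y ↔ ψ.Realize ![x, y, c, d]

/-- The variety `V(A'(T))` is axiomatized by a finite set of identities
(which hold in `A'(T)`). -/
def FinitelyBased (T : TM) : Prop :=
  ∃ E : List ((Sig T).Term ℕ × (Sig T).Term ℕ),
    (∀ e ∈ E, ∀ v : ℕ → El T, e.1.realize v = e.2.realize v) ∧
    ∀ (B : Type) [(Sig T).Structure B],
      (InVariety T B ↔ ∀ e ∈ E, ∀ v : ℕ → B, e.1.realize v = e.2.realize v)

/-- An algebra is subdirectly irreducible iff some pair `a ≠ b` (generating the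
monolith) belongs to every nontrivial congruence. -/
def IsSI (L : Language) (B : Type*) [L.Structure B] : Prop :=
  ∃ a b : B, a ≠ b ∧ ∀ c d : B, c ≠ d → PrinCg L B c d a b

/-- An algebra is finitely subdirectly irreducible iff any two nontrivial principal
congruences have nontrivial intersection. -/
def IsFSI (L : Language) (B : Type*) [L.Structure B] : Prop :=
  ∀ a b c d : B, a ≠ b → c ≠ d →
    ∃ x y : B, x ≠ y ∧ PrinCg L B a b x y ∧ PrinCg L B c d x y

/-- The residual bound of `V(A'(T))` is finite (`κ(A'(T)) < ω`): there is a finite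
bound strictly larger than the cardinality of every subdirectly irreducible member. -/
def ResBoundFinite (T : TM) : Prop :=
  ∃ N : ℕ, ∀ (B : Type) [(Sig T).Structure B],
    InVariety T B → IsSI (Sig T) B → Finite B ∧ Nat.card B < N

/-- Membership in `HS(A'(T))`: homomorphic images of subalgebras of `A'(T)`. -/
def InHS (T : TM) (B : Type*) [(Sig T).Structure B] : Prop :=
  ∃ (S : (Sig T).Substructure (El T)) (f : S →[Sig T] B), Function.Surjective f

/-- The constant `0` of an algebra in the signature of `A'(T)`. -/
def zeroB (T : TM) (B : Type*) [(Sig T).Structure B] : B :=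
  Structure.funMap (fn0 T) (fun i : Fin 0 => i.elim0)

/-- The meet operation of an algebra in the signature of `A'(T)`. -/
def meetB (T : TM) {B : Type*} [(Sig T).Structure B] (x y : B) : B :=
  Structure.funMap (fn2 T Ops2.meet) ![x, y]

/-- The multiplication of an algebra in the signature of `A'(T)`. -/
def mulB (T : TM) {B : Type*} [(Sig T).Structure B] (x y : B) : B :=
  Structure.funMap (fn2 T Ops2.mul) ![x, y]

/-- The operation `I` of an algebra in the signature of `A'(T)`. -/
def IB (T : TM) {B : Type*} [(Sig T).Structure B] (x : B) : B :=
  Structure.funMap (fn1 T Ops1.I) ![x]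

/-- The operation `J` of an algebra in the signature of `A'(T)`. -/
def JB (T : TM) {B : Type*} [(Sig T).Structure B] (x y z : B) : B :=
  Structure.funMap (fn3 T Ops3.J) ![x, y, z]

/-- The operation `J'` of an algebra in the signature of `A'(T)`. -/
def J'B (T : TM) {B : Type*} [(Sig T).Structure B] (x y z : B) : B :=
  Structure.funMap (fn3 T Ops3.J') ![x, y, z]

/-- The operation `K` of an algebra in the signature of `A'(T)`. -/
def KB (T : TM) {B : Type*} [(Sig T).Structure B] (x y z : B) : B :=
  Structure.funMap (fn3 T Ops3.K) ![x, y, z]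

/-- The operation `S₂` of an algebra in the signature of `A'(T)`. -/
def S2B (T : TM) {B : Type*} [(Sig T).Structure B] (u v x y z : B) : B :=
  Structure.funMap (fn5 T Ops5.S2) ![u, v, x, y, z]

/-- The term `e₂(m,n,x) = S₂(m,n,x,x,x)`. -/
def e2B (T : TM) {B : Type*} [(Sig T).Structure B] (m n x : B) : B :=
  S2B T m n x x x

/-- The semilattice order of an algebra in the signature of `A'(T)`:
`x ≤ y` iff `x ∧ y = x`. -/
def leB (T : TM) {B : Type*} [(Sig T).Structure B] (x y : B) : Prop :=
  meetB T x y = x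

/-- Parameters `m̄ ∈ B² ∪ B` for one of the operations `S₀`, `S₁`, `S₂`. -/
inductive SIdx (B : Type*) : Type _
  | s0 (m : B)
  | s1 (m : B)
  | s2 (m n : B)

/-- Which of `S₀, S₁, S₂` a parameter tuple belongs to. -/
def SIdx.tag {B : Type*} : SIdx B → Fin 3
  | .s0 _ => 0
  | .s1 _ => 1
  | .s2 _ _ => 2

/-- `SApp T σ x y z` is `S_i(m̄, x, y, z)` where `σ` packages `i` and `m̄`. -/
def SApp (T : TM) {B : Type*} [(Sig T).Structure B] : SIdx B → B → B → B → B
  | .s0 m, x, y, z => Structure.funMap (fn4 T Ops4.S0) ![m, x, y, z]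
  | .s1 m, x, y, z => Structure.funMap (fn4 T Ops4.S1) ![m, x, y, z]
  | .s2 m n, x, y, z => S2B T m n x y z

/-- `eApp T σ x` is the term function `e_i(m̄, x) = S_i(m̄, x, x, x)`. -/
def eApp (T : TM) {B : Type*} [(Sig T).Structure B] (σ : SIdx B) (x : B) : B :=
  SApp T σ x x x

/-- `Range(S_j)`: the set of values of the operation `S_j` on `B`. -/
def SRange (T : TM) (B : Type*) [(Sig T).Structure B] (j : Fin 3) : Set B :=
  {w | ∃ (σ : SIdx B) (x y z : B), σ.tag = j ∧ SApp T σ x y z = w}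

/-- A unary polynomial of `B`: a term function in one variable with parameters
from `B`. -/
def IsPolynomial (T : TM) {B : Type*} [(Sig T).Structure B] (f : B → B) : Prop :=
  ∃ t : (Sig T).Term (B ⊕ Unit), ∀ x : B, f x = t.realize (Sum.elim id fun _ => x)

/-- A fundamental translation: a unary polynomial obtained from a fundamental
operation by fixing all arguments but one. -/
def IsFundTranslation (T : TM) {B : Type*} [(Sig T).Structure B] (g : B → B) : Prop :=
  ∃ (n : ℕ) (F : (Sig T).Functions n) (i : Fin n) (v : Fin n → B),
    g = fun x => Structure.funMap F (Function.update v i x)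

/-- A polynomial generated by fundamental translations: a composition of finitely
many fundamental translations. -/
inductive IsTransPoly (T : TM) {B : Type*} [(Sig T).Structure B] : (B → B) → Prop
  | id : IsTransPoly T id
  | comp {g f : B → B} : IsFundTranslation T g → IsTransPoly T f → IsTransPoly T (g ∘ f)

end McKenzie

namespace McKenzie

namespace El

variable {T : TM}

theorem bar_symm {x y : El T} (h : bar x = some y) : bar y = some x := by
  cases x <;> simp [bar] at h <;> subst h <;> simp [bar]

theorem bar_ne_zero {x y : El T} (h : bar x = some y) : x ≠ zero := by
  rintro rfl; simp [bar] at h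

theorem bar_ne {x y : El T} (h : bar x = some y) : x ≠ y := by
  rintro rfl; cases x <;> simp [bar] at h

/-- A unary map that, wherever it is nonzero, agrees up to `∂` with a map `g` compatible
with `∂`. -/
def BarCompat (φ g : El T → El T) : Prop :=
  ∀ x, φ x ≠ zero → x ≠ zero ∧ (g x = φ x ∨ bar (g x) = some (φ x)) ∧
    ∀ z, bar z = some x → bar (g z) = some (g x)

/-- A unary map that vanishes at `0` and at every element having a bar. -/
def Unbarred (φ : El T → El T) : Prop :=
  ∀ x, φ x ≠ zero → x ≠ zero ∧ bar x = none

/-- Monotonicity of a unary map in the flat order. -/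
def FlatMono (φ : El T → El T) : Prop :=
  ∀ x, φ zero = zero ∨ φ zero = φ x

theorem FlatMono.of_zero {φ : El T → El T} (h : ∀ x, φ x ≠ zero → x ≠ zero) : FlatMono φ :=
  fun _ => Or.inl (by by_contra h0; exact h zero h0 rfl)

theorem BarCompat.flatMono {φ g : El T → El T} (h : BarCompat φ g) : FlatMono φ :=
  .of_zero fun x hx => (h x hx).1

theorem Unbarred.flatMono {φ : El T → El T} (h : Unbarred φ) : FlatMono φ :=
  .of_zero fun x hx => (h x hx).1

theorem barCompat_id {φ : El T → El T}
    (h : ∀ x, φ x ≠ zero → x = φ x ∨ bar x = some (φ x)) : BarCompat φ fun x => x := by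
  intro x hx
  refine ⟨?_, h x hx, fun _ hz => hz⟩
  rcases h x hx with h | h
  · rwa [h]
  · exact bar_ne_zero h

theorem meet_left (b : El T) : BarCompat (fun x => meet x b) fun x => x :=
  barCompat_id fun x => by unfold meet; split_ifs <;> simp

theorem meet_right (a : El T) : BarCompat (fun x => meet a x) fun x => x :=
  barCompat_id fun x => by unfold meet; split_ifs <;> simp_all

theorem opJ_fst (b c : El T) : BarCompat (fun x => opJ x b c) fun x => x :=
  barCompat_id fun x => by unfold opJ meet; split_ifs <;> simp

theorem opJ_snd (a c : El T) : BarCompat (fun x => opJ a x c) fun x => x :=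
  barCompat_id fun x => by unfold opJ meet; split_ifs <;> simp_all

theorem opJ'_fst (b c : El T) : BarCompat (fun x => opJ' x b c) fun x => x :=
  barCompat_id fun x => by unfold opJ' meet; split_ifs <;> simp

theorem opJ'_snd (a c : El T) : BarCompat (fun x => opJ' a x c) fun x => x :=
  barCompat_id fun x => by unfold opJ' meet; split_ifs <;> simp_all

theorem opK_fst (b c : El T) : BarCompat (fun x => opK x b c) fun x => x :=
  barCompat_id fun x => by
    unfold opK meet
    split_ifs with h1 h2 <;> simp
    · exact fun _ => Or.inr (bar_symm h1)
    · exact fun _ => Or.inr (bar_symm h2.2)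

theorem opK_snd (a c : El T) : BarCompat (fun x => opK a x c) fun x => x :=
  barCompat_id fun x => by
    unfold opK meet
    split_ifs with h1 h2 h3 h4
    · exact fun _ => Or.inl rfl
    · exact fun _ => Or.inr (bar_symm (h2.2.trans (congrArg some h2.1)))
    all_goals simp_all

theorem mul_ne_zero {w x : El T} (h : mul w x ≠ zero) :
    w ≠ zero ∧ bar w = none ∧ x ≠ zero ∧
      ∀ z, bar z = some x → bar (mul w z) = some (mul w x) := by
  refine ⟨?_, ?_, ?_, fun z hz => ?_⟩
  · rintro rfl; simp [mul] at h
  · cases w <;> simp [mul] at h <;> simp [bar]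
  · rintro rfl; cases w <;> simp [mul] at h
  · cases w <;> cases x <;> simp [mul, bar] at h hz <;> cases z <;> simp_all [mul, bar]

/-- The properties of the machine operations that matter for separation. -/
theorem mach_ne_zero {ins : Instr T.states} {t : Bool} {x y u : El T}
    (h : mach ins t x y u ≠ zero) :
    (x ≠ zero ∧ bar x = none) ∧ (y ≠ zero ∧ bar y = none) ∧ u ≠ zero ∧
      ∀ z, bar z = some u → bar (mach ins t x y z) = some (mach ins t x y u) := by
  have key : ∀ z, bar z = some u → bar (mach ins t x y z) = some (mach ins t x y u) := by
    intro z hz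
    unfold mach at *
    cases x <;> cases y <;> cases u <;> simp [opL, opR] at h <;>
      cases z <;> simp [bar] at hz <;> obtain ⟨rfl, hz⟩ := hz <;>
      split_ifs at h ⊢ <;> simp_all [opL, opR, bar]
  refine ⟨?_, ?_, ?_, key⟩
  · unfold mach at h
    cases x <;> simp [opL, opR] at h <;> simp [bar]
  · unfold mach at h
    cases y <;> simp [opL, opR] at h <;> simp [bar]
  · unfold mach at h
    rintro rfl
    cases x <;> cases y <;> simp [opL, opR] at h

theorem mul_fst (x : El T) : Unbarred fun w => mul w x :=
  fun _ h => ⟨(mul_ne_zero h).1, (mul_ne_zero h).2.1⟩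

theorem mul_snd (w : El T) : BarCompat (fun x => mul w x) fun x => mul w x :=
  fun _ h => ⟨(mul_ne_zero h).2.2.1, Or.inl rfl, (mul_ne_zero h).2.2.2⟩

theorem mach_fst (ins : Instr T.states) (t : Bool) (y u : El T) :
    Unbarred fun x => mach ins t x y u :=
  fun _ h => (mach_ne_zero h).1

theorem mach_snd (ins : Instr T.states) (t : Bool) (x u : El T) :
    Unbarred fun y => mach ins t x y u :=
  fun _ h => (mach_ne_zero h).2.1

theorem mach_thd (ins : Instr T.states) (t : Bool) (x y : El T) :
    BarCompat (fun u => mach ins t x y u) fun u => mach ins t x y u :=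
  fun _ h => ⟨(mach_ne_zero h).2.2.1, Or.inl rfl, (mach_ne_zero h).2.2.2⟩

theorem opI_unbarred : Unbarred (opI (T := T)) := by
  intro x h
  cases x <;> simp [opI] at h <;> simp [bar]

theorem bar_of_getD_ne_zero {x : El T} (h : (bar x).getD zero ≠ zero) :
    bar x = some ((bar x).getD zero) := by
  cases hx : bar x <;> simp_all

theorem opT_ne_zero {w x y z : El T} (h : opT w x y z ≠ zero) :
    mul w x ≠ zero ∧ mul w x = mul y z ∧
      (mul w x = opT w x y z ∨ bar (mul w x) = some (opT w x y z)) := by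
  unfold opT at *
  split_ifs at h ⊢ with h1 h2 h3
  · exact ⟨h, h1, Or.inl rfl⟩
  · exact ⟨h3, h1, Or.inr (bar_of_getD_ne_zero h)⟩
  all_goals exact absurd rfl h

theorem opT_fst (x y z : El T) : Unbarred fun w => opT w x y z :=
  fun w h => mul_fst x w (opT_ne_zero h).1

theorem opT_snd (w y z : El T) : BarCompat (fun x => opT w x y z) fun x => mul w x :=
  fun x h =>
    have h' := mul_snd w x (opT_ne_zero h).1
    ⟨h'.1, (opT_ne_zero h).2.2, h'.2.2⟩

theorem opT_thd (w x z : El T) : Unbarred fun y => opT w x y z :=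
  fun y h => mul_fst z y ((opT_ne_zero h).2.1.symm.trans_ne (opT_ne_zero h).1)

theorem opT_fth (w x y : El T) : BarCompat (fun z => opT w x y z) fun z => mul y z :=
  fun z h => by
    obtain ⟨h0, h1, h2⟩ := opT_ne_zero h
    rw [h1] at h0 h2
    have h' := mul_snd y z h0
    exact ⟨h'.1, h2, h'.2.2⟩

theorem prec_unbarred {x z : El T} (h : prec x z = true) :
    (x ≠ zero ∧ bar x = none) ∧ (z ≠ zero ∧ bar z = none) := by
  cases x <;> cases z <;> simp [prec] at h <;> simp [bar]

theorem opU1_ne_zero {F : El T → El T → El T → El T} {x y z u : El T}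
    (h : opU1 F x y z u ≠ zero) :
    prec x z = true ∧ F x y u ≠ zero ∧
      (F x y u = opU1 F x y z u ∨ bar (F x y u) = some (opU1 F x y z u)) := by
  unfold opU1 at *
  split_ifs at h ⊢ with h1 h2 h3
  · exact ⟨h1, h, Or.inl rfl⟩
  · exact ⟨h1, h3, Or.inr (bar_of_getD_ne_zero h)⟩
  all_goals exact absurd rfl h

theorem opU0_ne_zero {F : El T → El T → El T → El T} {x y z u : El T}
    (h : opU0 F x y z u ≠ zero) :
    prec x z = true ∧ F y z u ≠ zero ∧
      (F y z u = opU0 F x y z u ∨ bar (F y z u) = some (opU0 F x y z u)) := by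
  unfold opU0 at *
  split_ifs at h ⊢ with h1 h2 h3
  · exact ⟨h1, h, Or.inl rfl⟩
  · exact ⟨h1, h3, Or.inr (bar_of_getD_ne_zero h)⟩
  all_goals exact absurd rfl h

section MachU

variable (ins : Instr T.states) (t : Bool)

theorem opU1_fst (y z u : El T) : Unbarred fun x => opU1 (mach ins t) x y z u :=
  fun _ h => (prec_unbarred (opU1_ne_zero h).1).1

theorem opU1_snd (x z u : El T) : Unbarred fun y => opU1 (mach ins t) x y z u :=
  fun _ h => (mach_ne_zero (opU1_ne_zero h).2.1).2.1

theorem opU1_thd (x y u : El T) : Unbarred fun z => opU1 (mach ins t) x y z u :=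
  fun _ h => (prec_unbarred (opU1_ne_zero h).1).2

theorem opU1_fth (x y z : El T) :
    BarCompat (fun u => opU1 (mach ins t) x y z u) fun u => mach ins t x y u :=
  fun u h =>
    have h' := mach_thd ins t x y u (opU1_ne_zero h).2.1
    ⟨h'.1, (opU1_ne_zero h).2.2, h'.2.2⟩

theorem opU0_fst (y z u : El T) : Unbarred fun x => opU0 (mach ins t) x y z u :=
  fun _ h => (prec_unbarred (opU0_ne_zero h).1).1

theorem opU0_snd (x z u : El T) : Unbarred fun y => opU0 (mach ins t) x y z u :=
  fun _ h => (mach_ne_zero (opU0_ne_zero h).2.1).1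

theorem opU0_thd (x y u : El T) : Unbarred fun z => opU0 (mach ins t) x y z u :=
  fun _ h => (prec_unbarred (opU0_ne_zero h).1).2

theorem opU0_fth (x y z : El T) :
    BarCompat (fun u => opU0 (mach ins t) x y z u) fun u => mach ins t y z u :=
  fun u h =>
    have h' := mach_thd ins t y z u (opU0_ne_zero h).2.1
    ⟨h'.1, (opU0_ne_zero h).2.2, h'.2.2⟩

end MachU

theorem opJ_thd_flatMono (a b : El T) : FlatMono (opJ a b) := by
  intro x; unfold opJ meet; split_ifs <;> simp_all

theorem opJ'_thd_flatMono (a b : El T) : FlatMono (opJ' a b) := by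
  intro x; unfold opJ' meet; split_ifs <;> simp_all

theorem opK_thd_flatMono (a b : El T) : FlatMono (opK a b) := by
  intro x; unfold opK meet; split_ifs <;> simp_all [bar]

theorem sCore_fst_flatMono (b c : El T) : FlatMono fun x => sCore x b c := by
  intro x; simp only [sCore, meet, fjoin]; split_ifs <;> simp_all

theorem sCore_snd_flatMono (a c : El T) : FlatMono fun x => sCore a x c := by
  intro x; simp only [sCore, meet, fjoin]; split_ifs <;> simp_all

theorem sCore_thd_flatMono (a b : El T) : FlatMono fun x => sCore a b x := by
  intro x; simp only [sCore, meet, fjoin]; split_ifs <;> simp_all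

end El

section Separation

open El

variable {T : TM} {β : Type*}

/-- The term `x ∧ y`. -/
def tMeet (x y : (Sig T).Term β) : (Sig T).Term β := .func (fn2 T .meet) ![x, y]

/-- The term `J(x,y,z)`. -/
def tJ (x y z : (Sig T).Term β) : (Sig T).Term β := .func (fn3 T .J) ![x, y, z]

/-- The term `J'(x,y,z)`. -/
def tJ' (x y z : (Sig T).Term β) : (Sig T).Term β := .func (fn3 T .J') ![x, y, z]

/-- The term `S_i(m̄,x,y,z)`. -/
def tS : SIdx ((Sig T).Term β) → (Sig T).Term β → (Sig T).Term β → (Sig T).Term β →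
    (Sig T).Term β
  | .s0 m, x, y, z => .func (fn4 T .S0) ![m, x, y, z]
  | .s1 m, x, y, z => .func (fn4 T .S1) ![m, x, y, z]
  | .s2 m n, x, y, z => .func (fn5 T .S2) ![m, n, x, y, z]

/-- The constant term `0`. -/
def tZero (T : TM) (β : Type*) : (Sig T).Term β := .func (fn0 T) fun i => i.elim0

/-- The condition on the parameters of `S_i` at a valuation. -/
def SCond (v : β → El T) : SIdx ((Sig T).Term β) → Prop
  | .s0 m => isV0 (m.realize v) = true
  | .s1 m => m.realize v = one ∨ m.realize v = two
  | .s2 m n => bar (n.realize v) = some (m.realize v)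

theorem tS_realize_pos {v : β → El T} {σ : SIdx ((Sig T).Term β)} (h : SCond v σ)
    (x y z : (Sig T).Term β) :
    (tS σ x y z).realize v = sCore (x.realize v) (y.realize v) (z.realize v) := by
  cases σ <;> exact if_pos h

theorem tS_realize_neg {v : β → El T} {σ : SIdx ((Sig T).Term β)} (h : ¬ SCond v σ)
    (x y z : (Sig T).Term β) : (tS σ x y z).realize v = zero := by
  cases σ <;> exact if_neg h

/-- A decision tree testing elements `z` against a target `y` (left if `z = y`, right if
`z = ∂y`). Its leaves give three ways of adjoining part of `y` to an element below `y`. -/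
inductive SepTree (T : TM) (β : Type*)
  | nothing
  | all
  | guard (σ : SIdx ((Sig T).Term β))
  | node (z : (Sig T).Term β) (l r : SepTree T β)

namespace SepTree

/-- The tree reaches an admissible leaf on the target value `y` at the valuation `v`:
`e` says that nothing needs to be adjoined, `N` that everything may be. -/
def Good (v : β → El T) (N e : Prop) (y : El T) : SepTree T β → Prop
  | nothing => e
  | all => N
  | guard σ => SCond v σ
  | node z l r => (z.realize v = y ∧ l.Good v N e y) ∨
      (bar (z.realize v) = some y ∧ r.Good v N e y)

/-- The term adjoining to `u` the part of `y` selected by the tree, where `ey` is the part of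
`y` that may be adjoined. -/
def join (y ey u : (Sig T).Term β) : SepTree T β → (Sig T).Term β
  | nothing => tMeet y u
  | all => y
  | guard σ => tS σ y ey u
  | node z l r => tMeet (tJ y z (r.join y ey u)) (tJ' y z (l.join y ey u))

/-- The tree obtained by testing images under `G` against an element equal to `G c` or
`∂(G c)`. -/
def transport (G : (Sig T).Term β → (Sig T).Term β) (c : (Sig T).Term β) :
    SepTree T β → SepTree T β
  | node z l r => node (G c) (node (G z) (l.transport G c) (r.transport G c))
      (node (G z) (r.transport G c) (l.transport G c))
  | t => t

/-- The leftmost leaf. -/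
def leftmost : SepTree T β → SepTree T β
  | node _ l _ => l.leftmost
  | t => t

theorem Good.mono {v : β → El T} {N e e' : Prop} {y : El T} (he : e → e') :
    ∀ {t : SepTree T β}, t.Good v N e y → t.Good v N e' y
  | nothing, h => he h
  | all, h => h
  | guard _, h => h
  | node _ _ _, h => h.imp (And.imp_right (Good.mono he)) (And.imp_right (Good.mono he))

theorem Good.leftmost {v : β → El T} {N e e' : Prop} {x y : El T} (he : e → e')
    (hx : bar x = none) :
    ∀ {t : SepTree T β}, t.Good v N e x → t.leftmost.Good v N e' y
  | nothing, h => he h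
  | all, h => h
  | guard _, h => h
  | node _ l _, h => by
      rcases h with h | h
      · exact Good.leftmost (t := l) he hx h.2
      · rw [bar_symm h.1] at hx
        cases hx

theorem Good.transport {v : β → El T} {N e e' : Prop} {y : El T} (he : e → e')
    {G : (Sig T).Term β → (Sig T).Term β} {g : El T → El T}
    (hG : ∀ z, (G z).realize v = g (z.realize v)) {c : (Sig T).Term β}
    (hy : g (c.realize v) = y ∨ bar (g (c.realize v)) = some y)
    (hg : ∀ z, bar z = some (c.realize v) → bar (g z) = some (g (c.realize v))) :
    ∀ {t : SepTree T β}, t.Good v N e (c.realize v) → (t.transport G c).Good v N e' y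
  | nothing, h => he h
  | all, h => h
  | guard _, h => h
  | node z l r, h => by
      simp only [SepTree.transport, Good, hG]
      rcases h with ⟨hz, h⟩ | ⟨hz, h⟩
      · have := Good.transport he hG hy hg h
        rw [hz]
        tauto
      · have := Good.transport he hG hy hg h
        rcases hy with hy | hy
        · exact Or.inl ⟨hy, Or.inr ⟨hy ▸ hg _ hz, this⟩⟩
        · have hz' := Option.some.inj ((bar_symm (hg _ hz)).symm.trans hy)
          exact Or.inr ⟨hy, Or.inl ⟨hz', this⟩⟩

theorem join_realize_of_target_eq_zero {v : β → El T} {y ey u : (Sig T).Term β}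
    (hy : y.realize v = zero) : ∀ t : SepTree T β, (t.join y ey u).realize v = zero
  | nothing => by
      change meet (y.realize v) _ = _
      rw [hy]; unfold meet; split_ifs <;> rfl
  | all => hy
  | guard σ => by
      by_cases h : SCond v σ
      · rw [join, tS_realize_pos h, hy]
        unfold sCore meet fjoin; split_ifs <;> rfl
      · exact tS_realize_neg h _ _ _
  | node z l r => by
      change meet (opJ (y.realize v) _ _) _ = _
      rw [hy]; unfold meet opJ meet; split_ifs <;> simp_all

theorem join_realize_node {v : β → El T} {y ey u z : (Sig T).Term β} {l r : SepTree T β} :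
    ((node z l r).join y ey u).realize v =
      meet (opJ (y.realize v) (z.realize v) ((r.join y ey u).realize v))
        (opJ' (y.realize v) (z.realize v) ((l.join y ey u).realize v)) := rfl

theorem join_realize_left {v : β → El T} {y ey u z : (Sig T).Term β} {l r : SepTree T β}
    (h : z.realize v = y.realize v) :
    ((node z l r).join y ey u).realize v = meet (y.realize v) ((l.join y ey u).realize v) := by
  rw [join_realize_node, h]
  unfold opJ opJ' meet
  split_ifs <;> simp_all

theorem join_realize_right {v : β → El T} {y ey u z : (Sig T).Term β} {l r : SepTree T β}
    (h : bar (z.realize v) = some (y.realize v)) :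
    ((node z l r).join y ey u).realize v = meet (y.realize v) ((r.join y ey u).realize v) := by
  have hne := (bar_ne h).symm
  rw [join_realize_node]
  unfold opJ opJ' meet
  split_ifs <;> simp_all

theorem join_realize_eq {v : β → El T} {N : Prop} {y ey u : (Sig T).Term β}
    (hu : ¬ N → u.realize v = y.realize v) (hey : N → ey.realize v = y.realize v)
    (hey' : ¬ N → ey.realize v = zero) :
    ∀ {t : SepTree T β}, t.Good v N (u.realize v = y.realize v) (y.realize v) →
      (t.join y ey u).realize v = y.realize v
  | nothing, h => by
      change meet (y.realize v) (u.realize v) = _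
      rw [show u.realize v = y.realize v from h]; simp [meet]
  | all, _ => rfl
  | guard σ, h => by
      rw [join, tS_realize_pos h]
      by_cases hN : N
      · rw [hey hN]; unfold sCore meet fjoin; split_ifs <;> simp_all
      · rw [hey' hN, hu hN]; unfold sCore meet fjoin; split_ifs <;> simp_all
  | node z l r, h => by
      rcases h with ⟨hz, h⟩ | ⟨hz, h⟩
      · rw [join_realize_left hz, join_realize_eq hu hey hey' h]; simp [meet]
      · rw [join_realize_right hz, join_realize_eq hu hey hey' h]; simp [meet]

theorem join_realize_eq_zero {v : β → El T} {N e : Prop} {y ey u : (Sig T).Term β}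
    (hN : ¬ N) (hu : u.realize v = zero) (hey : ey.realize v = zero) :
    ∀ {t : SepTree T β}, t.Good v N e (y.realize v) → (t.join y ey u).realize v = zero
  | nothing, _ => by
      change meet (y.realize v) (u.realize v) = _
      rw [hu]; unfold meet; split_ifs <;> simp_all
  | all, h => absurd h hN
  | guard σ, h => by
      rw [join, tS_realize_pos h, hey, hu]
      unfold sCore meet fjoin; split_ifs <;> simp_all
  | node z l r, h => by
      rcases h with ⟨hz, h⟩ | ⟨hz, h⟩
      · rw [join_realize_left hz, join_realize_eq_zero hN hu hey h]
        unfold meet; split_ifs <;> simp_all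
      · rw [join_realize_right hz, join_realize_eq_zero hN hu hey h]
        unfold meet; split_ifs <;> simp_all

end SepTree

/-- `c₁` extends `c₀` at valuations in `N` only, and some decision tree adjoins to `c₀` the
missing part of `c₁`. -/
def SepExt (N : (β → El T) → Prop) (c₀ c₁ : (Sig T).Term β) : Prop :=
  (∀ v : β → El T, c₀.realize v = zero ∨ c₀.realize v = c₁.realize v) ∧
  (∀ v : β → El T, ¬ N v → c₀.realize v = c₁.realize v) ∧
  ∃ t : SepTree T β, ∀ v : β → El T, c₁.realize v ≠ zero →
    t.Good v (N v) (c₀.realize v = c₁.realize v) (c₁.realize v)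

namespace SepExt

variable {N : (β → El T) → Prop} {c₀ c₁ : (Sig T).Term β}

/-- `φ` acts on terms as `φv v` does on their values at `v`. -/
def Acts (φ : (Sig T).Term β → (Sig T).Term β) (φv : (β → El T) → El T → El T) : Prop :=
  ∀ v x, (φ x).realize v = φv v (x.realize v)

theorem of_tree (h : SepExt N c₀ c₁) {φ : (Sig T).Term β → (Sig T).Term β}
    {φv : (β → El T) → El T → El T} (hφ : Acts φ φv) (hm : ∀ v, FlatMono (φv v))
    (t : SepTree T β)
    (ht : ∀ v, φv v (c₁.realize v) ≠ zero →
      t.Good v (N v) (φv v (c₀.realize v) = φv v (c₁.realize v)) (φv v (c₁.realize v))) :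
    SepExt N (φ c₀) (φ c₁) := by
  refine ⟨fun v => ?_, fun v hv => ?_, t, fun v => ?_⟩
  · rw [hφ, hφ]
    rcases h.1 v with h | h
    · rw [h]; exact hm v _
    · rw [h]; exact Or.inr rfl
  · rw [hφ, hφ, h.2.1 v hv]
  · rw [hφ, hφ]; exact ht v

theorem of_barCompat {φ G : (Sig T).Term β → (Sig T).Term β}
    {φv g : (β → El T) → El T → El T} (hb : ∀ v, BarCompat (φv v) (g v))
    (hφ : Acts φ φv) (hG : Acts G g) (h : SepExt N c₀ c₁) : SepExt N (φ c₀) (φ c₁) := by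
  obtain ⟨t, ht⟩ := h.2.2
  refine h.of_tree hφ (fun v => (hb v).flatMono) (t.transport G c₁) fun v hv => ?_
  obtain ⟨h0, h1, h2⟩ := hb v _ hv
  exact (ht v h0).transport (congrArg _) (hG v) h1 h2

theorem of_unbarred {φ : (Sig T).Term β → (Sig T).Term β} {φv : (β → El T) → El T → El T}
    (hb : ∀ v, Unbarred (φv v)) (hφ : Acts φ φv) (h : SepExt N c₀ c₁) :
    SepExt N (φ c₀) (φ c₁) := by
  obtain ⟨t, ht⟩ := h.2.2
  refine h.of_tree hφ (fun v => (hb v).flatMono) t.leftmost fun v hv => ?_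
  obtain ⟨h0, h1⟩ := hb v _ hv
  exact (ht v h0).leftmost (congrArg _) h1

theorem opJ_thd (a b : (Sig T).Term β) (h : SepExt N c₀ c₁) :
    SepExt N (tJ a b c₀) (tJ a b c₁) := by
  obtain ⟨t, ht⟩ := h.2.2
  refine h.of_tree (φ := tJ a b) (φv := fun v => opJ (a.realize v) (b.realize v))
    (fun _ _ => rfl) (fun v => opJ_thd_flatMono _ _) (.node b .nothing t) fun v hv => ?_
  have he : c₀.realize v = c₁.realize v → opJ (a.realize v) (b.realize v) (c₀.realize v) =
      opJ (a.realize v) (b.realize v) (c₁.realize v) := congrArg _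
  by_cases h1 : a.realize v = b.realize v
  · have e : ∀ c, opJ (a.realize v) (b.realize v) c = b.realize v :=
      fun c => (if_pos h1).trans h1
    rw [e, e]
    exact Or.inl ⟨rfl, rfl⟩
  by_cases h2 : bar (b.realize v) = some (a.realize v)
  · have e : opJ (a.realize v) (b.realize v) (c₁.realize v) =
        meet (a.realize v) (c₁.realize v) := by rw [opJ, if_neg h1, if_pos h2]
    have h3 : a.realize v = c₁.realize v := by
      by_contra h3
      exact hv (e.trans (if_neg h3))
    have e' : opJ (a.realize v) (b.realize v) (c₁.realize v) = c₁.realize v := by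
      rw [e, h3, meet, if_pos rfl]
    rw [e'] at hv he ⊢
    exact Or.inr ⟨h2.trans (congrArg some h3), (ht v hv).mono he⟩
  · exact absurd (by rw [opJ, if_neg h1, if_neg h2]) hv

theorem opJ'_thd (a b : (Sig T).Term β) (h : SepExt N c₀ c₁) :
    SepExt N (tJ' a b c₀) (tJ' a b c₁) := by
  obtain ⟨t, ht⟩ := h.2.2
  refine h.of_tree (φ := tJ' a b) (φv := fun v => opJ' (a.realize v) (b.realize v))
    (fun _ _ => rfl) (fun v => opJ'_thd_flatMono _ _) (.node b t .nothing) fun v hv => ?_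
  have he : c₀.realize v = c₁.realize v → opJ' (a.realize v) (b.realize v) (c₀.realize v) =
      opJ' (a.realize v) (b.realize v) (c₁.realize v) := congrArg _
  by_cases h1 : a.realize v = b.realize v
  · have e : opJ' (a.realize v) (b.realize v) (c₁.realize v) =
        meet (a.realize v) (c₁.realize v) := if_pos h1
    have h3 : a.realize v = c₁.realize v := by
      by_contra h3
      exact hv (e.trans (if_neg h3))
    have e' : opJ' (a.realize v) (b.realize v) (c₁.realize v) = c₁.realize v := by
      rw [e, h3, meet, if_pos rfl]
    rw [e'] at hv he ⊢
    exact Or.inl ⟨h1.symm.trans h3, (ht v hv).mono he⟩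
  by_cases h2 : bar (b.realize v) = some (a.realize v)
  · have e : ∀ c, opJ' (a.realize v) (b.realize v) c = a.realize v := fun c => by
      rw [opJ', if_neg h1, if_pos h2]
    rw [e, e]
    exact Or.inr ⟨h2, rfl⟩
  · exact absurd (by rw [opJ', if_neg h1, if_neg h2]) hv

theorem opK_thd (a b : (Sig T).Term β) (h : SepExt N c₀ c₁) :
    SepExt N (.func (fn3 T .K) ![a, b, c₀]) (.func (fn3 T .K) ![a, b, c₁]) := by
  obtain ⟨t, ht⟩ := h.2.2
  refine h.of_tree (φ := fun x => .func (fn3 T .K) ![a, b, x])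
    (φv := fun v => opK (a.realize v) (b.realize v))
    (fun _ _ => rfl) (fun v => opK_thd_flatMono _ _)
    (.node b (.node a t .nothing) t) fun v hv => ?_
  have he : c₀.realize v = c₁.realize v → opK (a.realize v) (b.realize v) (c₀.realize v) =
      opK (a.realize v) (b.realize v) (c₁.realize v) := congrArg _
  by_cases h1 : bar (b.realize v) = some (a.realize v)
  · have e : ∀ c, opK (a.realize v) (b.realize v) c = b.realize v := fun c => if_pos h1
    rw [e, e]
    exact Or.inl ⟨rfl, Or.inr ⟨bar_symm h1, rfl⟩⟩
  by_cases h2 : a.realize v = b.realize v ∧ bar (c₁.realize v) = some (a.realize v)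
  · have e : opK (a.realize v) (b.realize v) (c₁.realize v) = c₁.realize v := by
      rw [opK, if_neg h1, if_pos h2]
    rw [e] at hv he ⊢
    exact Or.inr ⟨h2.1 ▸ bar_symm h2.2, (ht v hv).mono he⟩
  · have e : opK (a.realize v) (b.realize v) (c₁.realize v) =
        meet (a.realize v) (meet (b.realize v) (c₁.realize v)) := by
      rw [opK, if_neg h1, if_neg h2]
    have h3 : b.realize v = c₁.realize v := by
      by_contra h3
      rw [e] at hv
      unfold meet at hv
      split_ifs at hv <;> simp_all
    have h4 : a.realize v = c₁.realize v := by
      by_contra h4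
      rw [e] at hv
      unfold meet at hv
      split_ifs at hv <;> simp_all
    have e' : opK (a.realize v) (b.realize v) (c₁.realize v) = c₁.realize v := by
      rw [e, h3, h4]; simp [meet]
    rw [e'] at hv he ⊢
    exact Or.inl ⟨h3, Or.inl ⟨h4, (ht v hv).mono he⟩⟩

theorem of_guard {φ : (Sig T).Term β → (Sig T).Term β} {φv : (β → El T) → El T → El T}
    (σ : SIdx ((Sig T).Term β)) (hφ : Acts φ φv) (hm : ∀ v, FlatMono (φv v))
    (hσ : ∀ v, ¬ SCond v σ → (φ c₁).realize v = zero) (h : SepExt N c₀ c₁) :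
    SepExt N (φ c₀) (φ c₁) :=
  h.of_tree hφ hm (.guard σ) fun v hv => by
    by_contra hs
    exact hv (hφ v c₁ ▸ hσ v hs)

open Classical in
theorem S_fst (σ : SIdx ((Sig T).Term β)) (b c : (Sig T).Term β) (h : SepExt N c₀ c₁) :
    SepExt N (tS σ c₀ b c) (tS σ c₁ b c) :=
  h.of_guard (φ := fun x => tS σ x b c) (φv := fun v x =>
      if SCond v σ then sCore x (b.realize v) (c.realize v) else zero) σ
    (fun v x => by
      dsimp only
      split_ifs with hs
      exacts [tS_realize_pos hs _ _ _, tS_realize_neg hs _ _ _])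
    (fun v => by split_ifs; exacts [sCore_fst_flatMono _ _, fun _ => Or.inl rfl])
    fun v hs => tS_realize_neg hs _ _ _

open Classical in
theorem S_snd (σ : SIdx ((Sig T).Term β)) (a c : (Sig T).Term β) (h : SepExt N c₀ c₁) :
    SepExt N (tS σ a c₀ c) (tS σ a c₁ c) :=
  h.of_guard (φ := fun x => tS σ a x c) (φv := fun v x =>
      if SCond v σ then sCore (a.realize v) x (c.realize v) else zero) σ
    (fun v x => by
      dsimp only
      split_ifs with hs
      exacts [tS_realize_pos hs _ _ _, tS_realize_neg hs _ _ _])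
    (fun v => by split_ifs; exacts [sCore_snd_flatMono _ _, fun _ => Or.inl rfl])
    fun v hs => tS_realize_neg hs _ _ _

open Classical in
theorem S_thd (σ : SIdx ((Sig T).Term β)) (a b : (Sig T).Term β) (h : SepExt N c₀ c₁) :
    SepExt N (tS σ a b c₀) (tS σ a b c₁) :=
  h.of_guard (φ := fun x => tS σ a b x) (φv := fun v x =>
      if SCond v σ then sCore (a.realize v) (b.realize v) x else zero) σ
    (fun v x => by
      dsimp only
      split_ifs with hs
      exacts [tS_realize_pos hs _ _ _, tS_realize_neg hs _ _ _])
    (fun v => by split_ifs; exacts [sCore_thd_flatMono _ _, fun _ => Or.inl rfl])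
    fun v hs => tS_realize_neg hs _ _ _

theorem S0_param (a b c : (Sig T).Term β) (h : SepExt N c₀ c₁) :
    SepExt N (tS (.s0 c₀) a b c) (tS (.s0 c₁) a b c) :=
  h.of_guard (φ := fun x => tS (.s0 x) a b c)
    (φv := fun v x => opS0 x (a.realize v) (b.realize v) (c.realize v)) (.s0 c₁)
    (fun _ _ => rfl) (fun _ _ => Or.inl rfl) fun _ hs => tS_realize_neg hs _ _ _

theorem S1_param (a b c : (Sig T).Term β) (h : SepExt N c₀ c₁) :
    SepExt N (tS (.s1 c₀) a b c) (tS (.s1 c₁) a b c) :=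
  h.of_guard (φ := fun x => tS (.s1 x) a b c)
    (φv := fun v x => opS1 x (a.realize v) (b.realize v) (c.realize v)) (.s1 c₁)
    (fun _ _ => rfl) (fun _ _ => Or.inl rfl) fun _ hs => tS_realize_neg hs _ _ _

theorem S2_param_fst (n a b c : (Sig T).Term β) (h : SepExt N c₀ c₁) :
    SepExt N (tS (.s2 c₀ n) a b c) (tS (.s2 c₁ n) a b c) :=
  h.of_guard (φ := fun x => tS (.s2 x n) a b c)
    (φv := fun v x => opS2 x (n.realize v) (a.realize v) (b.realize v) (c.realize v))
    (.s2 c₁ n) (fun _ _ => rfl)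
    (fun _ _ => Or.inl (if_neg fun hn => bar_ne_zero (bar_symm hn) rfl))
    fun _ hs => tS_realize_neg hs _ _ _

theorem S2_param_snd (m a b c : (Sig T).Term β) (h : SepExt N c₀ c₁) :
    SepExt N (tS (.s2 m c₀) a b c) (tS (.s2 m c₁) a b c) :=
  h.of_guard (φ := fun x => tS (.s2 m x) a b c)
    (φv := fun v x => opS2 (m.realize v) x (a.realize v) (b.realize v) (c.realize v))
    (.s2 m c₁) (fun _ _ => rfl) (fun _ _ => Or.inl (if_neg fun hn => bar_ne_zero hn rfl))
    fun _ hs => tS_realize_neg hs _ _ _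

/-- `SepExt` is preserved by every fundamental translation. -/
theorem func_update {n : ℕ} (F : (Sig T).Functions n) (w : Fin n → (Sig T).Term β) (i : Fin n)
    (h : SepExt N c₀ c₁) :
    SepExt N (.func F (Function.update w i c₀)) (.func F (Function.update w i c₁)) := by
  rw [← FinVec.etaExpand_eq (Function.update w i c₀),
    ← FinVec.etaExpand_eq (Function.update w i c₁)]
  match n, F, w, i with
  | 0, _, _, i => exact i.elim0
  | 1, Ops1.I, w, i =>
    fin_cases i
    exact of_unbarred (φ := fun x => .func (fn1 T .I) ![x]) (fun _ => opI_unbarred)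
      (fun _ _ => rfl) h
  | 2, Ops2.meet, w, i =>
    fin_cases i
    · exact of_barCompat (φ := fun x => .func (fn2 T .meet) ![x, w 1])
        (G := fun x => x)
        (fun v => meet_left ((w 1).realize v))
        (fun _ _ => rfl) (fun _ _ => rfl) h
    · exact of_barCompat (φ := fun x => .func (fn2 T .meet) ![w 0, x])
        (G := fun x => x)
        (fun v => meet_right ((w 0).realize v))
        (fun _ _ => rfl) (fun _ _ => rfl) h
  | 2, Ops2.mul, w, i =>
    fin_cases i
    · exact of_unbarred (φ := fun x => .func (fn2 T .mul) ![x, w 1])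
        (fun v => mul_fst ((w 1).realize v))
        (fun _ _ => rfl) h
    · exact of_barCompat (φ := fun x => .func (fn2 T .mul) ![w 0, x])
        (G := fun x => .func (fn2 T .mul) ![w 0, x])
        (fun v => mul_snd ((w 0).realize v))
        (fun _ _ => rfl) (fun _ _ => rfl) h
  | 3, Ops3.J, w, i =>
    fin_cases i
    · exact of_barCompat (φ := fun x => .func (fn3 T .J) ![x, w 1, w 2])
        (G := fun x => x)
        (fun v => opJ_fst ((w 1).realize v) ((w 2).realize v))
        (fun _ _ => rfl) (fun _ _ => rfl) h
    · exact of_barCompat (φ := fun x => .func (fn3 T .J) ![w 0, x, w 2])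
        (G := fun x => x)
        (fun v => opJ_snd ((w 0).realize v) ((w 2).realize v))
        (fun _ _ => rfl) (fun _ _ => rfl) h
    · exact h.opJ_thd (w 0) (w 1)
  | 3, Ops3.J', w, i =>
    fin_cases i
    · exact of_barCompat (φ := fun x => .func (fn3 T .J') ![x, w 1, w 2])
        (G := fun x => x)
        (fun v => opJ'_fst ((w 1).realize v) ((w 2).realize v))
        (fun _ _ => rfl) (fun _ _ => rfl) h
    · exact of_barCompat (φ := fun x => .func (fn3 T .J') ![w 0, x, w 2])
        (G := fun x => x)
        (fun v => opJ'_snd ((w 0).realize v) ((w 2).realize v))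
        (fun _ _ => rfl) (fun _ _ => rfl) h
    · exact h.opJ'_thd (w 0) (w 1)
  | 3, Ops3.K, w, i =>
    fin_cases i
    · exact of_barCompat (φ := fun x => .func (fn3 T .K) ![x, w 1, w 2])
        (G := fun x => x)
        (fun v => opK_fst ((w 1).realize v) ((w 2).realize v))
        (fun _ _ => rfl) (fun _ _ => rfl) h
    · exact of_barCompat (φ := fun x => .func (fn3 T .K) ![w 0, x, w 2])
        (G := fun x => x)
        (fun v => opK_snd ((w 0).realize v) ((w 2).realize v))
        (fun _ _ => rfl) (fun _ _ => rfl) h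
    · exact h.opK_thd (w 0) (w 1)
  | 3, Ops3.mach k t, w, i =>
    fin_cases i
    · exact of_unbarred (φ := fun x => .func (fn3 T (.mach k t)) ![x, w 1, w 2])
        (fun v => mach_fst _ _ ((w 1).realize v) ((w 2).realize v))
        (fun _ _ => rfl) h
    · exact of_unbarred (φ := fun x => .func (fn3 T (.mach k t)) ![w 0, x, w 2])
        (fun v => mach_snd _ _ ((w 0).realize v) ((w 2).realize v))
        (fun _ _ => rfl) h
    · exact of_barCompat (φ := fun x => .func (fn3 T (.mach k t)) ![w 0, w 1, x])
        (G := fun x => .func (fn3 T (.mach k t)) ![w 0, w 1, x])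
        (fun v => mach_thd _ _ ((w 0).realize v) ((w 1).realize v))
        (fun _ _ => rfl) (fun _ _ => rfl) h
  | 4, Ops4.S0, w, i =>
    fin_cases i
    · exact h.S0_param (w 1) (w 2) (w 3)
    · exact h.S_fst (.s0 (w 0)) (w 2) (w 3)
    · exact h.S_snd (.s0 (w 0)) (w 1) (w 3)
    · exact h.S_thd (.s0 (w 0)) (w 1) (w 2)
  | 4, Ops4.S1, w, i =>
    fin_cases i
    · exact h.S1_param (w 1) (w 2) (w 3)
    · exact h.S_fst (.s1 (w 0)) (w 2) (w 3)
    · exact h.S_snd (.s1 (w 0)) (w 1) (w 3)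
    · exact h.S_thd (.s1 (w 0)) (w 1) (w 2)
  | 4, Ops4.T, w, i =>
    fin_cases i
    · exact of_unbarred (φ := fun x => .func (fn4 T .T) ![x, w 1, w 2, w 3])
        (fun v => opT_fst ((w 1).realize v) ((w 2).realize v) ((w 3).realize v))
        (fun _ _ => rfl) h
    · exact of_barCompat (φ := fun x => .func (fn4 T .T) ![w 0, x, w 2, w 3])
        (G := fun x => .func (fn2 T .mul) ![w 0, x])
        (fun v => opT_snd ((w 0).realize v) ((w 2).realize v) ((w 3).realize v))
        (fun _ _ => rfl) (fun _ _ => rfl) h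
    · exact of_unbarred (φ := fun x => .func (fn4 T .T) ![w 0, w 1, x, w 3])
        (fun v => opT_thd ((w 0).realize v) ((w 1).realize v) ((w 3).realize v))
        (fun _ _ => rfl) h
    · exact of_barCompat (φ := fun x => .func (fn4 T .T) ![w 0, w 1, w 2, x])
        (G := fun x => .func (fn2 T .mul) ![w 2, x])
        (fun v => opT_fth ((w 0).realize v) ((w 1).realize v) ((w 2).realize v))
        (fun _ _ => rfl) (fun _ _ => rfl) h
  | 4, Ops4.u1 k t, w, i =>
    fin_cases i
    · exact of_unbarred (φ := fun x => .func (fn4 T (.u1 k t)) ![x, w 1, w 2, w 3])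
        (fun v => opU1_fst _ _ ((w 1).realize v) ((w 2).realize v) ((w 3).realize v))
        (fun _ _ => rfl) h
    · exact of_unbarred (φ := fun x => .func (fn4 T (.u1 k t)) ![w 0, x, w 2, w 3])
        (fun v => opU1_snd _ _ ((w 0).realize v) ((w 2).realize v) ((w 3).realize v))
        (fun _ _ => rfl) h
    · exact of_unbarred (φ := fun x => .func (fn4 T (.u1 k t)) ![w 0, w 1, x, w 3])
        (fun v => opU1_thd _ _ ((w 0).realize v) ((w 1).realize v) ((w 3).realize v))
        (fun _ _ => rfl) h
    · exact of_barCompat (φ := fun x => .func (fn4 T (.u1 k t)) ![w 0, w 1, w 2, x])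
        (G := fun x => .func (fn3 T (.mach k t)) ![w 0, w 1, x])
        (fun v => opU1_fth _ _ ((w 0).realize v) ((w 1).realize v) ((w 2).realize v))
        (fun _ _ => rfl) (fun _ _ => rfl) h
  | 4, Ops4.u0 k t, w, i =>
    fin_cases i
    · exact of_unbarred (φ := fun x => .func (fn4 T (.u0 k t)) ![x, w 1, w 2, w 3])
        (fun v => opU0_fst _ _ ((w 1).realize v) ((w 2).realize v) ((w 3).realize v))
        (fun _ _ => rfl) h
    · exact of_unbarred (φ := fun x => .func (fn4 T (.u0 k t)) ![w 0, x, w 2, w 3])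
        (fun v => opU0_snd _ _ ((w 0).realize v) ((w 2).realize v) ((w 3).realize v))
        (fun _ _ => rfl) h
    · exact of_unbarred (φ := fun x => .func (fn4 T (.u0 k t)) ![w 0, w 1, x, w 3])
        (fun v => opU0_thd _ _ ((w 0).realize v) ((w 1).realize v) ((w 3).realize v))
        (fun _ _ => rfl) h
    · exact of_barCompat (φ := fun x => .func (fn4 T (.u0 k t)) ![w 0, w 1, w 2, x])
        (G := fun x => .func (fn3 T (.mach k t)) ![w 1, w 2, x])
        (fun v => opU0_fth _ _ ((w 0).realize v) ((w 1).realize v) ((w 2).realize v))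
        (fun _ _ => rfl) (fun _ _ => rfl) h
  | 5, Ops5.S2, w, i =>
    fin_cases i
    · exact h.S2_param_fst (w 1) (w 2) (w 3) (w 4)
    · exact h.S2_param_snd (w 0) (w 2) (w 3) (w 4)
    · exact h.S_fst (.s2 (w 0) (w 1)) (w 3) (w 4)
    · exact h.S_snd (.s2 (w 0) (w 1)) (w 2) (w 4)
    · exact h.S_thd (.s2 (w 0) (w 1)) (w 2) (w 3)
  | _ + 6, F, _, _ => exact F.elim

theorem func {n : ℕ} (F : (Sig T).Functions n) {w₀ w₁ : Fin n → (Sig T).Term β}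
    (h : ∀ i, Relation.ReflTransGen (SepExt N) (w₀ i) (w₁ i)) :
    Relation.ReflTransGen (SepExt N) (.func F w₀) (.func F w₁) := by
  classical
  suffices H : ∀ s : Finset (Fin n),
      Relation.ReflTransGen (SepExt N) (.func F w₀) (.func F (s.piecewise w₁ w₀)) by
    simpa using H Finset.univ
  intro s
  induction s using Finset.induction_on with
  | empty => simpa using Relation.ReflTransGen.refl
  | insert i s hi ih =>
    refine ih.trans ?_
    have hlift := (h i).lift
      (fun x => Language.Term.func F (Function.update (s.piecewise w₁ w₀) i x))
      fun _ _ hxy => func_update F _ i hxy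
    rw [Finset.piecewise_insert]
    convert hlift using 2
    rw [Function.eq_update_self_iff]
    exact Finset.piecewise_eq_of_notMem _ _ _ hi

/-- Substituting `s`, supported on `N`, for `0` in a term yields a chain of separated
extensions. -/
theorem subst (t : (Sig T).Term (β ⊕ Unit)) {s : (Sig T).Term β}
    (hs : ∀ v : β → El T, ¬ N v → s.realize v = zero) :
    Relation.ReflTransGen (SepExt N) (t.subst (Sum.elim .var fun _ => tZero T β))
      (t.subst (Sum.elim .var fun _ => s)) := by
  induction t with
  | var a =>
    rcases a with b | _
    · exact .refl
    · refine .single ⟨fun v => Or.inl rfl, fun v hv => (hs v hv).symm, .all, fun v hv => ?_⟩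
      by_contra hN
      exact hv (hs v hN)
  | func F ts ih => exact func F ih

theorem realize_of_reflTransGen (h : Relation.ReflTransGen (SepExt N) c₀ c₁)
    (v : β → El T) : c₀.realize v = zero ∨ c₀.realize v = c₁.realize v := by
  induction h with
  | refl => exact Or.inr rfl
  | tail _ h ih =>
    rcases ih with ih | ih
    · exact Or.inl ih
    · rw [ih]; exact h.1 v

end SepExt

theorem realize_tMeet {B : Type*} [(Sig T).Structure B] (v : β → B) (x y : (Sig T).Term β) :
    (tMeet x y).realize v = meetB T (x.realize v) (y.realize v) :=
  congrArg (Language.Structure.funMap _) (by funext i; fin_cases i <;> rfl)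

theorem realize_tJ {B : Type*} [(Sig T).Structure B] (v : β → B) (x y z : (Sig T).Term β) :
    (tJ x y z).realize v = JB T (x.realize v) (y.realize v) (z.realize v) :=
  congrArg (Language.Structure.funMap _) (by funext i; fin_cases i <;> rfl)

theorem realize_tJ' {B : Type*} [(Sig T).Structure B] (v : β → B) (x y z : (Sig T).Term β) :
    (tJ' x y z).realize v = J'B T (x.realize v) (y.realize v) (z.realize v) :=
  congrArg (Language.Structure.funMap _) (by funext i; fin_cases i <;> rfl)

theorem realize_tZero {B : Type*} [(Sig T).Structure B] (v : β → B) :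
    (tZero T β).realize v = zeroB T B :=
  congrArg (Language.Structure.funMap _) (by funext i; exact i.elim0)

/-- The value of a parameter tuple of terms. -/
def SIdx.realize {B : Type*} [(Sig T).Structure B] (v : β → B) :
    SIdx ((Sig T).Term β) → SIdx B
  | .s0 m => .s0 (m.realize v)
  | .s1 m => .s1 (m.realize v)
  | .s2 m n => .s2 (m.realize v) (n.realize v)

theorem realize_tS {B : Type*} [(Sig T).Structure B] (v : β → B) (σ : SIdx ((Sig T).Term β))
    (x y z : (Sig T).Term β) :
    (tS σ x y z).realize v =
      SApp T (σ.realize v) (x.realize v) (y.realize v) (z.realize v) := by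
  cases σ <;>
    exact congrArg (Language.Structure.funMap _) (by funext i; fin_cases i <;> rfl)

/-- A parameter tuple as a tuple of variables. -/
def SIdx.toTerm (T : TM) {B : Type*} : SIdx B → SIdx ((Sig T).Term B)
  | .s0 m => .s0 (.var m)
  | .s1 m => .s1 (.var m)
  | .s2 m n => .s2 (.var m) (.var n)

theorem SIdx.realize_toTerm {B : Type*} [(Sig T).Structure B] (σ : SIdx B) :
    (σ.toTerm T).realize id = σ := by
  cases σ <;> rfl

theorem SepTree.join_congr {B : Type*} [(Sig T).Structure B] {v : β → B}
    {y ey u u' : (Sig T).Term β} (h : u.realize v = u'.realize v) :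
    ∀ t : SepTree T β, (t.join y ey u).realize v = (t.join y ey u').realize v
  | .nothing => by simp only [join, realize_tMeet, h]
  | .all => rfl
  | .guard _ => by simp only [join, realize_tS, h]
  | .node _ l r => by
      simp only [join, realize_tMeet, realize_tJ, realize_tJ', join_congr h l, join_congr h r]

/-- Identities of an algebra, over any nonempty set of variables, hold in its variety. -/
theorem ModelsIdsOf.realize_eq {L : FirstOrder.Language} {A B : Type*} [L.Structure A]
    [L.Structure B] (h : ModelsIdsOf L A B) {β : Type*} [Nonempty β] {t₁ t₂ : L.Term β}
    (ht : ∀ v : β → A, t₁.realize v = t₂.realize v) (v : β → B) :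
    t₁.realize v = t₂.realize v := by
  classical
  have key : ∀ (t : L.Term β) (w w' : β → B), (∀ b ∈ t.varFinset, w b = w' b) →
      t.realize w = t.realize w' := by
    intro t w w' hw
    induction t with
    | var b => exact hw b (by simp [FirstOrder.Language.Term.varFinset])
    | func F ts ih =>
      refine congrArg (FirstOrder.Language.Structure.funMap F) (funext fun i => ih i ?_)
      exact fun b hb => hw b (by
        simp only [FirstOrder.Language.Term.varFinset, Finset.mem_biUnion]
        exact ⟨i, Finset.mem_univ i, hb⟩)
  let s := t₁.varFinset ∪ t₂.varFinset
  let g : β → ℕ := fun b => if hb : b ∈ s then s.equivFin ⟨b, hb⟩ else 0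
  have hg : Set.InjOn g s := by
    intro a ha b hb hab
    simp only [g, dif_pos (Finset.mem_coe.1 ha), dif_pos (Finset.mem_coe.1 hb)] at hab
    simpa using s.equivFin.injective (Fin.ext hab)
  have hinv : ∀ b ∈ s, (v ∘ Function.invFunOn g s) (g b) = v b := fun b hb =>
    congrArg v (hg.leftInvOn_invFunOn (Finset.mem_coe.2 hb))
  have h' := h (t₁.relabel g) (t₂.relabel g) (fun w => by
    simpa only [FirstOrder.Language.Term.realize_relabel] using ht _)
      (v ∘ Function.invFunOn g s)
  simp only [FirstOrder.Language.Term.realize_relabel] at h'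
  exact (key t₁ _ v fun b hb => hinv b (Finset.mem_union_left _ hb)).symm.trans
    (h'.trans (key t₂ _ v fun b hb => hinv b (Finset.mem_union_right _ hb)))

theorem realize_tS_self (v : β → El T) (σ : SIdx ((Sig T).Term β)) (x : (Sig T).Term β)
    (h : SCond v σ) : (tS σ x x x).realize v = x.realize v := by
  rw [tS_realize_pos h]
  simp [sCore, meet, fjoin]

/-- Being fixed by `e_i(m̄, ·)` in an algebra of the variety passes along separated
extensions. -/
theorem SepExt.eApp_eq {B : Type*} [(Sig T).Structure B] (hB : InVariety T B)
    {σ : SIdx ((Sig T).Term B)} {c₀ c₁ : (Sig T).Term B}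
    (h : SepExt (fun v => SCond v σ) c₀ c₁) (h₀ : (tS σ c₀ c₀ c₀).realize id = c₀.realize id) :
    (tS σ c₁ c₁ c₁).realize id = c₁.realize id := by
  have : Nonempty B := ⟨zeroB T B⟩
  obtain ⟨-, hN, t, ht⟩ := h
  have h1 : (t.join c₁ (tS σ c₁ c₁ c₁) c₀).realize id = c₁.realize id := by
    refine hB.realize_eq (fun v => ?_) id
    by_cases hv : c₁.realize v = zero
    · rw [SepTree.join_realize_of_target_eq_zero hv, hv]
    · exact SepTree.join_realize_eq (hN v) (realize_tS_self v σ c₁)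
        (fun hs => tS_realize_neg hs _ _ _) (ht v hv)
  have h2 : (t.join c₁ (tS σ c₁ c₁ c₁) (tS σ c₀ c₀ c₀)).realize id =
      (tS σ c₁ c₁ c₁).realize id := by
    refine hB.realize_eq (fun v => ?_) id
    by_cases hs : SCond v σ
    · rw [SepTree.join_congr (realize_tS_self v σ c₀ hs), realize_tS_self v σ c₁ hs]
      by_cases hv : c₁.realize v = zero
      · rw [SepTree.join_realize_of_target_eq_zero hv, hv]
      · exact SepTree.join_realize_eq (hN v) (realize_tS_self v σ c₁)
          (fun hs => tS_realize_neg hs _ _ _) (ht v hv)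
    · rw [tS_realize_neg hs]
      by_cases hv : c₁.realize v = zero
      · exact SepTree.join_realize_of_target_eq_zero hv _
      · exact SepTree.join_realize_eq_zero hs (tS_realize_neg hs _ _ _)
          (tS_realize_neg hs _ _ _) (ht v hv)
  rw [← h2, SepTree.join_congr h₀, h1]

theorem El.sCore_map_of_meet {φ : El T → El T} (p q : El T) {c d : El T}
    (hφ : φ zero = zero ∨ φ zero = φ c) (hd : d = zero ∨ d = c) :
    sCore (φ (sCore p q c)) (φ (sCore p q d)) (φ c) = φ (sCore p q c) ∧
    sCore (φ (sCore p q c)) (φ (sCore p q d)) (φ d) = φ (sCore p q d) := by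
  have self : ∀ a b : El T, sCore a a b = a := fun a b => by
    simp only [sCore, meet, fjoin]; split_ifs <;> simp_all
  have outer : ∀ a b : El T, b = zero ∨ b = a → sCore a b b = b := fun a b h => by
    rcases h with rfl | rfl
    · simp only [sCore, meet, fjoin]; split_ifs <;> simp_all
    · exact self _ _
  have third : ∀ a b : El T, b = zero ∨ b = a → sCore a b a = a := fun a b h => by
    simp only [sCore, meet, fjoin]; split_ifs <;> simp_all
  rcases hd with rfl | rfl
  · by_cases h : sCore p q c = sCore p q zero
    · rw [h]; exact ⟨self _ _, self _ _⟩
    · have h0 : sCore p q zero = zero := by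
        revert h; simp only [sCore, meet, fjoin]; split_ifs <;> simp_all
      have hc : sCore p q c = c := by
        revert h; simp only [sCore, meet, fjoin]; split_ifs <;> simp_all
      rw [h0, hc]
      exact ⟨third _ _ hφ, outer _ _ hφ⟩
  · exact ⟨self _ _, self _ _⟩

/-- Evaluating a unary polynomial, given as a term with parameters, at a term. -/
theorem realize_subst_elim {M : Type*} [(Sig T).Structure M] (t : (Sig T).Term (β ⊕ Unit))
    (x : (Sig T).Term β) (v : β → M) :
    (t.subst (Sum.elim .var fun _ => x)).realize v =
      t.realize (Sum.elim v fun _ => x.realize v) := by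
  rw [FirstOrder.Language.Term.realize_subst]
  congr 1
  funext a
  rcases a with a | a <;> rfl

end Separation

/-- Let `B ∈ V(A'(T))`, let `f(x)` be a `0`-absorbing unary
polynomial of `B`, and let `g(x) = f(S_j(n̄,p,q,x))` for some `j ∈ {0,1,2}`,
`n̄ ∈ B² ∪ B` and `p, q ∈ B`.  If `c, d ∈ B` with `d ≤ c`, then
`g'(x) = S_j(n̄, g(c), g(d), f(x))` satisfies `g'(c) = g(c)` and `g'(d) = g(d)`. -/
theorem S_commutes_zero_absorbing (T : TM) (B : Type*) [(Sig T).Structure B]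
    (hB : InVariety T B)
    (f : B → B) (hf : IsPolynomial T f) (hf0 : f (zeroB T B) = zeroB T B)
    (σ : SIdx B) (p q : B)
    (g : B → B) (hg : g = fun x => f (SApp T σ p q x))
    (c d : B) (hdc : leB T d c) :
    SApp T σ (g c) (g d) (f c) = g c ∧ SApp T σ (g c) (g d) (f d) = g d := by
  have : Nonempty B := ⟨f (zeroB T B)⟩
  obtain ⟨t, ht⟩ := hf
  let sub (x : (Sig T).Term B) := t.subst (Sum.elim .var fun _ => x)
  have hsub : ∀ x, (sub x).realize id = f (x.realize id) := fun x => by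
    rw [realize_subst_elim, ht]
  let ρ := σ.toTerm T
  have hρ : ρ.realize id = σ := σ.realize_toTerm
  let s (x : (Sig T).Term B) := tS ρ (.var p) (.var q) x
  have hgs : ∀ x, (sub (s x)).realize id = g (x.realize id) := fun x => by
    rw [hsub, realize_tS, hρ, hg]
    rfl
  have hfix : ∀ x, (tS ρ (sub (s x)) (sub (s x)) (sub (s x))).realize id =
      (sub (s x)).realize id := fun x => by
    have hchain := SepExt.subst (N := fun v => SCond v ρ) t (s := s x)
      fun v hv => tS_realize_neg hv _ _ _
    have h0 : (tS ρ (tZero T B) (tZero T B) (tZero T B)).realize id =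
        (tZero T B).realize id := by
      refine hB.realize_eq (fun v => ?_) id
      by_cases hv : SCond v ρ
      · exact realize_tS_self v ρ _ hv
      · exact tS_realize_neg hv _ _ _
    refine Relation.ReflTransGen.head_induction_on
      (motive := fun c₀ _ => (tS ρ c₀ c₀ c₀).realize id = c₀.realize id → _) hchain
      id (fun h _ ih h₀ => ih (h.eApp_eq hB h₀)) ?_
    have hz : (sub (tZero T B)).realize id = (tZero T B).realize id := by
      rw [hsub, realize_tZero, hf0]
    rw [realize_tS] at h0 ⊢
    change SApp T _ ((sub (tZero T B)).realize id) ((sub (tZero T B)).realize id)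
      ((sub (tZero T B)).realize id) = (sub (tZero T B)).realize id
    rw [hz, h0]
  let dc : (Sig T).Term B := tMeet (.var d) (.var c)
  have hd : dc.realize id = d := (realize_tMeet _ _ _).trans hdc
  have hpt : ∀ v : B → El T, SCond v ρ →
      (tS ρ (sub (s (.var c))) (sub (s dc)) (sub (.var c))).realize v =
        (sub (s (.var c))).realize v ∧
      (tS ρ (sub (s (.var c))) (sub (s dc)) (sub dc)).realize v =
        (sub (s dc)).realize v := fun v hv => by
    have hm := SepExt.realize_of_reflTransGen
      (SepExt.subst (N := fun _ => True) t (s := .var c) fun _ h => absurd trivial h) v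
    change (sub (tZero T B)).realize v = _ ∨ (sub (tZero T B)).realize v =
      (sub (.var c)).realize v at hm
    have hdc' : dc.realize v = El.zero ∨ dc.realize v = v c := by
      change El.meet (v d) (v c) = _ ∨ El.meet (v d) (v c) = _
      unfold El.meet
      split_ifs with h
      exacts [Or.inr h, Or.inl rfl]
    simp only [tS_realize_pos hv, sub, realize_subst_elim, s] at hm ⊢
    exact El.sCore_map_of_meet (φ := fun x => t.realize (Sum.elim v fun _ => x)) _ _ hm hdc'
  have key : ∀ a b y z : (Sig T).Term B, (∀ v : B → El T, SCond v ρ →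
      (tS ρ a b y).realize v = z.realize v) →
      (tS ρ a b y).realize id = (tS ρ z z z).realize id := fun a b y z h =>
    hB.realize_eq (fun v => by
      by_cases hv : SCond v ρ
      · rw [h v hv, realize_tS_self v ρ z hv]
      · rw [tS_realize_neg hv, tS_realize_neg hv]) id
  have h1 := (key _ _ _ _ fun v hv => (hpt v hv).1).trans (hfix _)
  have h2 := (key _ _ _ _ fun v hv => (hpt v hv).2).trans (hfix _)
  simp only [realize_tS, hρ, hgs, hsub, hd] at h1 h2
  exact ⟨h1, h2⟩

end McKenzie
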